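/- Assume T(𝓛) acts transitively on 𝓛, that |𝓛| is a prime power, and that T(𝓛) contains a long cycle (a cycle of length |𝓛|). Then the action of T(𝓛) on 𝓛 is primitive. -/

import Mathlib

open scoped symmDiff

namespace TogglePaper

variable {E : Type*} [DecidableEq E]

/-- The toggle `τ_e` on the collection `L` of subsets of the ground set. -/
def toggle (L : Finset (Finset E)) (e : E) : Equiv.Perm {A : Finset E // A ∈ L} :=
  Function.Involutive.toPerm
    (fun X => if h : X.1 ∆ ({e} : Finset E) ∈ L then ⟨X.1 ∆ ({e} : Finset E), h⟩ else X)
    (by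
      intro X
      by_cases h : X.1 ∆ ({e} : Finset E) ∈ L
      · have h2 : (X.1 ∆ ({e} : Finset E)) ∆ ({e} : Finset E) = X.1 :=
          symmDiff_symmDiff_cancel_right _ _
        simp only [dif_pos h, h2]
        simp [h2, X.2]
      · simp [h])

/-- The generalized toggle group `T(L)`. -/
def toggleGroup (L : Finset (Finset E)) : Subgroup (Equiv.Perm {A : Finset E // A ∈ L}) :=
  Subgroup.closure (Set.range (toggle L))

/-- `T(L)` acts transitively on `L`. -/
def IsTransitive (L : Finset (Finset E)) : Prop :=
  ∀ A B : {A : Finset E // A ∈ L}, ∃ g ∈ toggleGroup L, g A = B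

/-- `B` is a block for the action of `T(L)` on `L`. -/
def IsBlock (L : Finset (Finset E)) (B : Finset {A : Finset E // A ∈ L}) : Prop :=
  ∀ g ∈ toggleGroup L, Finset.image g B = B ∨ Disjoint (Finset.image g B) B

/-- `Blocks` is a block system for `T(L)`: a partition of `L` into nonempty blocks
that is permuted by every element of `T(L)`. -/
def IsBlockSystem (L : Finset (Finset E))
    (Blocks : Finset (Finset {A : Finset E // A ∈ L})) : Prop :=
  (∀ B ∈ Blocks, B.Nonempty) ∧
  (∀ A : {A : Finset E // A ∈ L}, ∃! B : Finset {A : Finset E // A ∈ L},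
      B ∈ Blocks ∧ A ∈ B) ∧
  (∀ g ∈ toggleGroup L, ∀ B ∈ Blocks, Finset.image g B ∈ Blocks)

/-- An element `g` of `T(L)` is type 2 (with respect to a fixed block system `Blocks`)
if it maps each block to itself; it is type 1 otherwise. -/
def IsType2 (L : Finset (Finset E)) (Blocks : Finset (Finset {A : Finset E // A ∈ L}))
    (g : Equiv.Perm {A : Finset E // A ∈ L}) : Prop :=
  ∀ B ∈ Blocks, Finset.image g B = B

/-- The action of `T(L)` on `L` is primitive: it is transitive and the only blocks
are the singletons, the empty set and the whole set. -/
def IsPrimitive (L : Finset (Finset E)) : Prop :=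
  IsTransitive L ∧
    ∀ B : Finset {A : Finset E // A ∈ L}, IsBlock L B → B.card ≤ 1 ∨ B = Finset.univ

/-- `T(L)` contains a long cycle, i.e. a cycle whose support is all of `L`. -/
def HasLongCycle (L : Finset (Finset E)) : Prop :=
  ∃ g ∈ toggleGroup L, g.IsCycle ∧ g.support = Finset.univ

section ToggleLemmas

variable {L : Finset (Finset E)}

theorem toggle_toggle (e : E) (X : {A : Finset E // A ∈ L}) :
    toggle L e (toggle L e X) = X :=
  Function.Involutive.toPerm_involutive _ X

theorem toggle_inv (e : E) : (toggle L e)⁻¹ = toggle L e :=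
  inv_eq_of_mul_eq_one_left (Equiv.ext fun X => toggle_toggle e X)

theorem toggle_mem (e : E) : toggle L e ∈ toggleGroup L :=
  Subgroup.subset_closure ⟨e, rfl⟩

theorem toggle_of_mem {e : E} {X : {A : Finset E // A ∈ L}} (h : X.1 ∆ {e} ∈ L) :
    toggle L e X = ⟨X.1 ∆ {e}, h⟩ :=
  dif_pos h

theorem toggle_of_notMem {e : E} {X : {A : Finset E // A ∈ L}} (h : X.1 ∆ {e} ∉ L) :
    toggle L e X = X :=
  dif_neg h

theorem toggle_ne_iff {e : E} {X : {A : Finset E // A ∈ L}} :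
    toggle L e X ≠ X ↔ X.1 ∆ {e} ∈ L := by
  refine ⟨fun h => by_contra fun h' => h (toggle_of_notMem h'), fun h h' => ?_⟩
  rw [toggle_of_mem h, Subtype.ext_iff] at h'
  simp [symmDiff_eq_left] at h'

theorem coe_toggle_of_ne {e : E} {X : {A : Finset E // A ∈ L}} (h : toggle L e X ≠ X) :
    (toggle L e X).1 = X.1 ∆ {e} := by
  rw [toggle_of_mem (toggle_ne_iff.1 h)]

/-- Since toggles are involutions, a submonoid-style induction suffices on the group they
generate. -/
theorem toggle_closure_induction {K : Set E}
    {p : Equiv.Perm {A : Finset E // A ∈ L} → Prop} (one : p 1)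
    (gen : ∀ e ∈ K, p (toggle L e)) (mul : ∀ g h, p g → p h → p (g * h))
    {g : Equiv.Perm {A : Finset E // A ∈ L}}
    (hg : g ∈ Subgroup.closure (toggle L '' K)) : p g := by
  induction hg using Subgroup.closure_induction'' with
  | mem x hx => obtain ⟨e, he, rfl⟩ := hx; exact gen e he
  | inv_mem x hx => obtain ⟨e, he, rfl⟩ := hx; rw [toggle_inv]; exact gen e he
  | one => exact one
  | mul x y _ _ hx hy => exact mul x y hx hy

theorem toggleGroup_eq : toggleGroup L = Subgroup.closure (toggle L '' Set.univ) := by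
  rw [Set.image_univ]; rfl

/-! ### Toggles and an invariant equivalence relation -/

section Invariant

variable {r : Setoid {A : Finset E // A ∈ L}}

/-- The equivalence relation is preserved by the toggle group. -/
def IsInvariant (L : Finset (Finset E)) (r : Setoid {A : Finset E // A ∈ L}) : Prop :=
  ∀ g ∈ toggleGroup L, ∀ X Y, r X Y → r (g X) (g Y)

/-- The elements whose toggles map every class of `r` to itself. -/
def innerSet (r : Setoid {A : Finset E // A ∈ L}) : Set E :=
  {e | ∀ X, r X (toggle L e X)}

/-- A toggle which moves a class moves each of its members. -/
theorem coe_toggle_of_rel_of_not_rel (hr : IsInvariant L r) {e : E}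
    {X Y : {A : Finset E // A ∈ L}} (hXY : r X Y) (hX : ¬ r X (toggle L e X)) :
    (toggle L e Y).1 = Y.1 ∆ {e} := by
  refine coe_toggle_of_ne fun h => hX ?_
  have := hr _ (toggle_mem e) _ _ hXY
  rw [h] at this
  exact r.trans hXY (r.symm this)

/-- Any two classes in the same orbit are related by a translation. -/
theorem exists_translate (hr : IsInvariant L r) {g : Equiv.Perm {A : Finset E // A ∈ L}}
    (hg : g ∈ toggleGroup L) (X : {A : Finset E // A ∈ L}) :
    ∃ S : Finset E, ∀ X', r X X' → ∃ Y, r (g X) Y ∧ Y.1 = X'.1 ∆ S := by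
  rw [toggleGroup_eq] at hg
  revert X
  refine toggle_closure_induction
    (p := fun g => ∀ X, ∃ S : Finset E, ∀ X', r X X' → ∃ Y, r (g X) Y ∧ Y.1 = X'.1 ∆ S)
    ?_ ?_ ?_ hg
  · exact fun X => ⟨∅, fun X' h => ⟨X', h, (symmDiff_bot _).symm⟩⟩
  · intro e _ X
    by_cases hX : r X (toggle L e X)
    · exact ⟨∅, fun X' h => ⟨X', r.trans (r.symm hX) h, (symmDiff_bot _).symm⟩⟩
    · exact ⟨{e}, fun X' h => ⟨toggle L e X', hr _ (toggle_mem e) _ _ h,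
        coe_toggle_of_rel_of_not_rel hr h hX⟩⟩
  · intro g h hg hh X
    obtain ⟨S, hS⟩ := hh X
    obtain ⟨T, hT⟩ := hg (h X)
    refine ⟨S ∆ T, fun X' hX' => ?_⟩
    obtain ⟨Y, hY, hY'⟩ := hS X' hX'
    obtain ⟨Z, hZ, hZ'⟩ := hT Y hY
    exact ⟨Z, hZ, by rw [hZ', hY', symmDiff_assoc]⟩

/-- A toggle that moves some class acts trivially on each class it stabilises. -/
theorem toggle_eq_self_of_rel (ht : IsTransitive L) (hr : IsInvariant L r) {e : E}
    (he : e ∉ innerSet r) {X : {A : Finset E // A ∈ L}} (hX : r X (toggle L e X)) :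
    toggle L e X = X := by
  by_contra hne
  obtain ⟨Z, hZ⟩ := not_forall.1 he
  obtain ⟨g, hg, rfl⟩ := ht X Z
  obtain ⟨S, hS⟩ := exists_translate hr hg X
  obtain ⟨Y, hY, hY'⟩ := hS X (r.refl X)
  obtain ⟨W, hW, hW'⟩ := hS _ hX
  have h1 := coe_toggle_of_rel_of_not_rel hr hY hZ
  have h2 : toggle L e Y = W := by
    apply Subtype.ext
    rw [h1, hW', hY', coe_toggle_of_ne hne, symmDiff_right_comm]
  have h3 := hr _ (toggle_mem e) _ _ hY
  rw [h2] at h3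
  exact hZ (r.trans hW (r.symm h3))

theorem commute_toggle (ht : IsTransitive L) (hr : IsInvariant L r) {e f : E}
    (he : e ∉ innerSet r) (hf : f ∈ innerSet r) :
    Commute (toggle L e) (toggle L f) := by
  have key : ∀ X, toggle L f X ≠ X → toggle L e (toggle L f X) = toggle L f (toggle L e X) := by
    intro X hX
    by_cases h : r X (toggle L e X)
    · have h1 : r (toggle L f X) (toggle L e (toggle L f X)) :=
        r.trans (r.symm (hf X)) (r.trans h (hr _ (toggle_mem e) _ _ (hf X)))
      rw [toggle_eq_self_of_rel ht hr he h, toggle_eq_self_of_rel ht hr he h1]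
    · have h1 := coe_toggle_of_rel_of_not_rel hr (hf X) h
      have h2 := coe_toggle_of_rel_of_not_rel hr (r.refl X) h
      rw [coe_toggle_of_ne hX, symmDiff_right_comm, ← h2] at h1
      have h3 : (toggle L e X).1 ∆ {f} ∈ L := h1 ▸ (toggle L e (toggle L f X)).2
      apply Subtype.ext
      rw [h1, toggle_of_mem h3]
  ext1 X
  change toggle L e (toggle L f X) = toggle L f (toggle L e X)
  by_cases hX : toggle L f X = X
  · by_cases hY : toggle L f (toggle L e X) = toggle L e X
    · rw [hX, hY]
    · have := key _ hY
      rw [toggle_toggle] at this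
      rw [hX] at this
      refine absurd ?_ hY
      conv_rhs => rw [← this]
      exact (toggle_toggle e _).symm
  · exact key X hX

/-- Every element of the toggle group splits as a product of an element generated by the
toggles moving classes and one generated by the class-preserving toggles. -/
theorem exists_mul_eq (ht : IsTransitive L) (hr : IsInvariant L r)
    {g : Equiv.Perm {A : Finset E // A ∈ L}} (hg : g ∈ toggleGroup L) :
    ∃ a ∈ Subgroup.closure (toggle L '' (innerSet r)ᶜ),
      ∃ b ∈ Subgroup.closure (toggle L '' innerSet r), a * b = g ∧ Commute a b := by
  have hcomm : ∀ a ∈ Subgroup.closure (toggle L '' (innerSet r)ᶜ),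
      ∀ b ∈ Subgroup.closure (toggle L '' innerSet r), Commute a b := by
    intro a ha b hb
    refine toggle_closure_induction (p := fun a => Commute a b) (Commute.one_left _) ?_
      (fun _ _ h1 h2 => h1.mul_left h2) ha
    intro e he
    exact toggle_closure_induction (p := fun b => Commute (toggle L e) b) (Commute.one_right _)
      (fun f hf => commute_toggle ht hr he hf) (fun _ _ h1 h2 => h1.mul_right h2) hb
  suffices h : ∃ a ∈ Subgroup.closure (toggle L '' (innerSet r)ᶜ),
      ∃ b ∈ Subgroup.closure (toggle L '' innerSet r), a * b = g by
    obtain ⟨a, ha, b, hb, h⟩ := h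
    exact ⟨a, ha, b, hb, h, hcomm a ha b hb⟩
  rw [toggleGroup_eq] at hg
  refine toggle_closure_induction (p := fun g => ∃ a ∈ Subgroup.closure (toggle L '' (innerSet r)ᶜ),
      ∃ b ∈ Subgroup.closure (toggle L '' innerSet r), a * b = g) ?_ ?_ ?_ hg
  · exact ⟨1, one_mem _, 1, one_mem _, one_mul 1⟩
  · intro e _
    by_cases he : e ∈ innerSet r
    · exact ⟨1, one_mem _, _, Subgroup.subset_closure ⟨e, he, rfl⟩, one_mul _⟩
    · exact ⟨_, Subgroup.subset_closure ⟨e, he, rfl⟩, 1, one_mem _, mul_one _⟩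
  · rintro _ _ ⟨a, ha, b, hb, rfl⟩ ⟨c, hc, d, hd, rfl⟩
    refine ⟨a * c, mul_mem ha hc, b * d, mul_mem hb hd, ?_⟩
    exact (hcomm c hc b hb).symm.mul_mul_mul_comm a d |>.symm

theorem rel_of_mem_closure_inner {b : Equiv.Perm {A : Finset E // A ∈ L}}
    (hb : b ∈ Subgroup.closure (toggle L '' innerSet r)) (X : {A : Finset E // A ∈ L}) :
    r X (b X) := by
  revert X
  exact toggle_closure_induction (p := fun b => ∀ X, r X (b X)) r.refl (fun e he => he)
    (fun g h hg hh X => r.trans (hh X) (hg (h X))) hb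

/-- A product of class-moving toggles acts on each class as a translation. -/
theorem exists_forall_coe_eq (ht : IsTransitive L) (hr : IsInvariant L r)
    {a : Equiv.Perm {A : Finset E // A ∈ L}}
    (ha : a ∈ Subgroup.closure (toggle L '' (innerSet r)ᶜ)) (X : {A : Finset E // A ∈ L}) :
    ∃ S : Finset E, ∀ X', r X X' → (a X').1 = X'.1 ∆ S := by
  suffices h : (∀ X Y, r X Y → r (a X) (a Y)) ∧
      ∀ X, ∃ S : Finset E, ∀ X', r X X' → (a X').1 = X'.1 ∆ S from h.2 X
  refine toggle_closure_induction (p := fun a => (∀ X Y, r X Y → r (a X) (a Y)) ∧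
      ∀ X, ∃ S : Finset E, ∀ X', r X X' → (a X').1 = X'.1 ∆ S) ?_ ?_ ?_ ha
  · exact ⟨fun _ _ h => h, fun X => ⟨∅, fun X' _ => (symmDiff_bot _).symm⟩⟩
  · refine fun e he => ⟨hr _ (toggle_mem e), fun X => ?_⟩
    by_cases hX : r X (toggle L e X)
    · refine ⟨∅, fun X' h => ?_⟩
      have h1 : r X' (toggle L e X') :=
        r.trans (r.symm h) (r.trans hX (hr _ (toggle_mem e) _ _ h))
      rw [toggle_eq_self_of_rel ht hr he h1]
      exact (symmDiff_bot _).symm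
    · exact ⟨{e}, fun X' h => coe_toggle_of_rel_of_not_rel hr h hX⟩
  · rintro g h ⟨hg, hg'⟩ ⟨hh, hh'⟩
    refine ⟨fun X Y hXY => hg _ _ (hh _ _ hXY), fun X => ?_⟩
    obtain ⟨S, hS⟩ := hh' X
    obtain ⟨T, hT⟩ := hg' (h X)
    refine ⟨S ∆ T, fun X' hX' => ?_⟩
    change (g (h X')).1 = _
    rw [hT _ (hh _ _ hX'), hS _ hX', symmDiff_assoc]

end Invariant

/-! ### Powers of a full cycle -/

section FullCycle

variable {α : Type*}

theorem mem_zpowers_of_commute {g a : Equiv.Perm α} (hg : ∀ x y, ∃ i : ℤ, (g ^ i) x = y)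
    (h : Commute g a) : a ∈ Subgroup.zpowers g := by
  rcases isEmpty_or_nonempty α with _ | ⟨⟨x⟩⟩
  · rw [Subsingleton.elim a 1]; exact one_mem _
  obtain ⟨i, hi⟩ := hg x (a x)
  refine ⟨i, Equiv.ext fun y => ?_⟩
  obtain ⟨j, rfl⟩ := hg x y
  change (g ^ i * g ^ j) x = (a * g ^ j) x
  rw [← (h.zpow_left j).eq, ← zpow_add, add_comm, zpow_add, Equiv.Perm.mul_apply,
    Equiv.Perm.mul_apply, hi]

theorem mem_zpowers_zpow_of_isCoprime {G : Type*} [Group G] {g : G} {n : ℕ} (hn : g ^ n = 1)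
    {i : ℤ} (h : IsCoprime i n) : g ∈ Subgroup.zpowers (g ^ i) := by
  obtain ⟨u, v, huv⟩ := h
  refine ⟨u, ?_⟩
  change (g ^ i) ^ u = g
  have : (g ^ i) ^ u = g ^ (u * i + v * n) := by
    rw [zpow_add, mul_comm v, zpow_mul g (n : ℤ), zpow_natCast, hn, one_zpow, mul_one, ← zpow_mul,
      mul_comm]
  rw [this, huv, zpow_one]

/-- If an element of prime power order is a product of two of its powers, it is a power of
one of them. -/
theorem mem_zpowers_or_of_mul_eq {G : Type*} [Group G] {g a b : G} {p k : ℕ} (hp : p.Prime)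
    (hk : k ≠ 0) (hg : orderOf g = p ^ k) (ha : a ∈ Subgroup.zpowers g)
    (hb : b ∈ Subgroup.zpowers g) (hab : a * b = g) :
    g ∈ Subgroup.zpowers a ∨ g ∈ Subgroup.zpowers b := by
  obtain ⟨i, rfl⟩ := ha
  obtain ⟨j, rfl⟩ := hb
  have hpow : g ^ (p ^ k) = 1 := hg ▸ pow_orderOf_eq_one g
  have hcop : ∀ i : ℤ, ¬ (p : ℤ) ∣ i → IsCoprime i ((p ^ k : ℕ) : ℤ) := by
    intro i hi
    rw [Nat.cast_pow]
    exact (((Nat.prime_iff_prime_int.1 hp).coprime_iff_not_dvd.2 hi).symm).pow_right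
  by_cases hi : (p : ℤ) ∣ i
  · by_cases hj : (p : ℤ) ∣ j
    · exfalso
      have h1 : g ^ (i + j - 1) = 1 := by
        rw [zpow_sub, zpow_add, zpow_one]
        exact mul_inv_eq_one.2 hab
      have h2 := orderOf_dvd_iff_zpow_eq_one.2 h1
      rw [hg, Nat.cast_pow] at h2
      have h3 := (dvd_pow_self (p : ℤ) hk).trans h2
      have h4 : (p : ℤ) ∣ 1 := (dvd_sub_right (dvd_add hi hj)).1 h3
      exact (Nat.prime_iff_prime_int.1 hp).not_dvd_one h4
    · exact Or.inr (mem_zpowers_zpow_of_isCoprime hpow (hcop j hj))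
  · exact Or.inl (mem_zpowers_zpow_of_isCoprime hpow (hcop i hi))

theorem zpow_transitive_of_mem_zpowers {g a : Equiv.Perm α}
    (hg : ∀ x y, ∃ i : ℤ, (g ^ i) x = y) (h : g ∈ Subgroup.zpowers a) (x y : α) :
    ∃ i : ℤ, (a ^ i) x = y := by
  obtain ⟨j, rfl⟩ := h
  obtain ⟨i, hi⟩ := hg x y
  exact ⟨j * i, by rw [zpow_mul]; exact hi⟩

end FullCycle

/-! ### Translations of the collection and parity of toggles -/

theorem card_eq_two_mul_card_filter {α : Type*} (T : Finset α) (P : α → Prop) [DecidablePred P]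
    (φ : α → α) (hφ : ∀ x, φ (φ x) = x) (hT : ∀ x ∈ T, φ x ∈ T)
    (hP : ∀ x ∈ T, (P (φ x) ↔ ¬ P x)) : T.card = 2 * (T.filter P).card := by
  rw [← Finset.card_filter_add_card_filter_not (s := T) P, two_mul]
  congr 1
  refine Finset.card_bij' (fun x _ => φ x) (fun x _ => φ x) ?_ ?_ (fun x _ => hφ x)
    (fun x _ => hφ x)
  · intro x hx
    rw [Finset.mem_filter] at hx ⊢
    exact ⟨hT x hx.1, by_contra fun h => hx.2 (by_contra fun h' => h ((hP x hx.1).2 h'))⟩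
  · intro x hx
    rw [Finset.mem_filter] at hx ⊢
    exact ⟨hT x hx.1, fun h => (hP x hx.1).1 h hx.2⟩

/-- If the collection is stable under a nonempty translation and its size is divisible by
four, then every toggle is even. -/
theorem sign_toggle_of_translate {S : Finset E} (hS : S.Nonempty)
    (hL : ∀ A ∈ L, A ∆ S ∈ L) (h4 : 4 ∣ L.card) (e : E) :
    Equiv.Perm.sign (toggle L e) = 1 := by
  have hsupp : 4 ∣ (toggle L e).support.card := by
    have hmem : ∀ X, X ∈ (toggle L e).support ↔ X.1 ∆ {e} ∈ L := fun X => by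
      rw [Equiv.Perm.mem_support, toggle_ne_iff]
    by_cases hSe : S = {e}
    · have : (toggle L e).support = Finset.univ :=
        Finset.eq_univ_of_forall fun X => (hmem X).2 (hSe ▸ hL X.1 X.2)
      rw [this, Finset.card_univ, Fintype.card_coe]
      exact h4
    · obtain ⟨s, hs, hse⟩ : ∃ s ∈ S, s ≠ e := by
        by_contra! h
        exact hSe ((Finset.eq_singleton_iff_nonempty_unique_mem).2 ⟨hS, h⟩)
      rw [card_eq_two_mul_card_filter _ (fun X => s ∈ X.1) (fun X => ⟨X.1 ∆ S, hL X.1 X.2⟩)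
          (fun X => Subtype.ext (symmDiff_symmDiff_cancel_right _ _)) ?_ ?_,
        card_eq_two_mul_card_filter _ (fun X => e ∈ X.1) (toggle L e) (toggle_toggle e) ?_ ?_]
      · exact ⟨_, (mul_assoc 2 2 _).symm⟩
      · intro X hX
        rw [Finset.mem_filter] at hX ⊢
        refine ⟨Equiv.Perm.apply_mem_support.2 hX.1, ?_⟩
        rw [coe_toggle_of_ne (Equiv.Perm.mem_support.1 hX.1)]
        simp [Finset.mem_symmDiff, hX.2, hse]
      · intro X hX
        rw [Finset.mem_filter] at hX
        rw [coe_toggle_of_ne (Equiv.Perm.mem_support.1 hX.1)]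
        simp [Finset.mem_symmDiff]
      · intro X hX
        rw [hmem] at hX ⊢
        rw [symmDiff_right_comm]
        exact hL _ hX
      · intro X _
        simp [Finset.mem_symmDiff, hs]
  have hsq : toggle L e ^ 2 = 1 := Equiv.ext fun X => by
    rw [pow_two]; exact toggle_toggle e X
  have hct := Equiv.Perm.cycleType_of_pow_prime_eq_one hsq
  have hsum := (toggle L e).sum_cycleType
  rw [hct, Multiset.sum_replicate, smul_eq_mul] at hsum
  rw [Equiv.Perm.sign_of_cycleType, Equiv.Perm.sum_cycleType]
  apply Even.neg_one_pow
  rw [Nat.even_iff]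
  omega

/-! ### Block systems of a toggle group with a full cycle -/

/-- An invariant equivalence relation for a toggle group of prime power degree with a full
cycle is trivial. -/
theorem eq_of_rel_of_not_rel (ht : IsTransitive L) (hpp : IsPrimePow L.card)
    (hlong : HasLongCycle L) {r : Setoid {A : Finset E // A ∈ L}} (hr : IsInvariant L r)
    {x y u v : {A : Finset E // A ∈ L}} (hxy : r x y) (huv : ¬ r u v) : x = y := by
  by_contra hne
  obtain ⟨g, hg, hcyc, hsupp⟩ := hlong
  have hgt : ∀ x y, ∃ i : ℤ, (g ^ i) x = y := fun x y =>
    hcyc.exists_zpow_eq (Equiv.Perm.mem_support.1 (hsupp ▸ Finset.mem_univ x))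
      (Equiv.Perm.mem_support.1 (hsupp ▸ Finset.mem_univ y))
  have hcard : g.support.card = L.card := by rw [hsupp, Finset.card_univ, Fintype.card_coe]
  have hord : orderOf g = L.card := by rw [hcyc.orderOf, hcard]
  obtain ⟨p, k, hp, hk, hpk⟩ := (isPrimePow_nat_iff _).1 hpp
  obtain ⟨a, ha, b, hb, hab, hcomm⟩ := exists_mul_eq ht hr hg
  have hga : Commute g a := hab ▸ (Commute.refl a).mul_left hcomm.symm
  have hgb : Commute g b := hab ▸ hcomm.mul_left (Commute.refl b)
  have hgpow : g ∈ Subgroup.zpowers a := by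
    refine (mem_zpowers_or_of_mul_eq hp hk.ne' (hord.trans hpk.symm)
      (mem_zpowers_of_commute hgt hga) (mem_zpowers_of_commute hgt hgb) hab).resolve_right
      fun h => huv ?_
    obtain ⟨i, rfl⟩ := zpow_transitive_of_mem_zpowers hgt h u v
    exact rel_of_mem_closure_inner (zpow_mem hb i) u
  have hat := zpow_transitive_of_mem_zpowers hgt hgpow
  obtain ⟨j, hj⟩ := hat x y
  set z := a ^ j with hz
  obtain ⟨S, hS⟩ := exists_forall_coe_eq ht hr (zpow_mem ha j) x
  rw [← hz] at hS
  have hyS : y.1 = x.1 ∆ S := by rw [← hS x (r.refl x), hj]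
  have hSne : S.Nonempty := by
    rw [Finset.nonempty_iff_ne_empty]
    rintro rfl
    exact hne (Subtype.ext (hyS.trans (symmDiff_bot _)).symm)
  have hzS : ∀ w, (z w).1 = w.1 ∆ S := by
    intro w
    obtain ⟨i, rfl⟩ := hat x w
    obtain ⟨R, hR⟩ := exists_forall_coe_eq ht hr (zpow_mem ha i) x
    have : z ((a ^ i) x) = (a ^ i) y := by
      rw [← hj, ← Equiv.Perm.mul_apply, ← Equiv.Perm.mul_apply, hz,
        ((Commute.refl a).zpow_zpow j i).eq]
    rw [this, hR y hxy, hR x (r.refl x), hyS, symmDiff_right_comm]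
  have hzsq : z ^ 2 = 1 := Equiv.ext fun w => Subtype.ext (by
    rw [pow_two, Equiv.Perm.mul_apply, hzS, hzS, symmDiff_symmDiff_cancel_right]; rfl)
  have hz1 : z ≠ 1 := fun h => hne (by rw [← hj, h]; rfl)
  have hzord : orderOf z = 2 := orderOf_eq_prime hzsq hz1
  have h2 : 2 ∣ p ^ k := by
    rw [hpk, ← hord, ← hzord]
    exact orderOf_dvd_of_mem_zpowers (mem_zpowers_of_commute hgt (hga.zpow_right j))
  have hp2 : p = 2 := ((Nat.prime_dvd_prime_iff_eq Nat.prime_two hp).1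
    (Nat.prime_two.dvd_of_dvd_pow h2)).symm
  subst hp2
  have h4 : 4 ∣ L.card := by
    have hlt : 2 < L.card := by
      have hthird : ∃ w, w ≠ x ∧ w ≠ y := by
        by_contra! h
        have hall : ∀ w, r x w := fun w => by
          by_cases hw : w = x
          · rw [hw]
          · rw [h w hw]; exact hxy
        exact huv (r.trans (r.symm (hall u)) (hall v))
      obtain ⟨w, hwx, hwy⟩ := hthird
      rw [← Fintype.card_coe, Fintype.two_lt_card_iff]
      exact ⟨x, y, w, hne, hwx.symm, hwy.symm⟩
    rw [← hpk] at hlt ⊢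
    have : 2 ≤ k := by
      by_contra! hk2
      have : 2 ^ k ≤ 2 ^ 1 := Nat.pow_le_pow_right two_pos (by omega)
      omega
    exact pow_dvd_pow 2 this
  have hsign : ∀ h ∈ toggleGroup L, Equiv.Perm.sign h = 1 := by
    intro h hh
    rw [toggleGroup_eq] at hh
    refine toggle_closure_induction (p := fun h => Equiv.Perm.sign h = 1) (map_one _) ?_ ?_ hh
    · exact fun e _ => sign_toggle_of_translate hSne (fun A hA => hzS ⟨A, hA⟩ ▸ (z ⟨A, hA⟩).2) h4 e
    · intro g h hg hh
      rw [map_mul, hg, hh, one_mul]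
  have h1 := hsign g hg
  rw [hcyc.sign, hcard, Even.neg_one_pow (even_iff_two_dvd.2 (dvd_trans (by norm_num) h4))] at h1
  exact absurd h1 (by decide)

/-- The equivalence relation whose classes are the translates of a block (in a transitive
action). -/
def blockSetoid (ht : IsTransitive L) {B : Finset {A : Finset E // A ∈ L}}
    (hB : IsBlock L B) (hne : B.Nonempty) : Setoid {A : Finset E // A ∈ L} where
  r X Y := ∃ g ∈ toggleGroup L, g X ∈ B ∧ g Y ∈ B
  iseqv :=
    { refl := fun X => by
        obtain ⟨b, hb⟩ := hne
        obtain ⟨g, hg, rfl⟩ := ht X b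
        exact ⟨g, hg, hb, hb⟩
      symm := fun ⟨g, hg, h1, h2⟩ => ⟨g, hg, h2, h1⟩
      trans := by
        rintro X Y Z ⟨g, hg, hX, hY⟩ ⟨h, hh, hY', hZ⟩
        refine ⟨h, hh, ?_, hZ⟩
        have himg : ∀ W, g W ∈ B → h W ∈ Finset.image (h * g⁻¹) B := fun W hW =>
          Finset.mem_image.2 ⟨g W, hW, by simp⟩
        rcases hB _ (mul_mem hh (inv_mem hg)) with heq | hdisj
        · exact heq ▸ himg X hX
        · exact absurd hY' (Finset.disjoint_left.1 hdisj (himg Y hY)) }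

theorem isInvariant_blockSetoid (ht : IsTransitive L) {B : Finset {A : Finset E // A ∈ L}}
    (hB : IsBlock L B) (hne : B.Nonempty) : IsInvariant L (blockSetoid ht hB hne) := by
  rintro g hg X Y ⟨h, hh, hX, hY⟩
  exact ⟨h * g⁻¹, mul_mem hh (inv_mem hg), by simpa using hX, by simpa using hY⟩

end ToggleLemmas

/-- a transitive toggle group of prime-power degree containing a long
cycle is primitive. -/
theorem prime_power_degree_with_long_cycle_is_primitive
    [Fintype E] (L : Finset (Finset E))
    (hnt : ∀ e : E, toggle L e ≠ 1)
    (htrans : IsTransitive L)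
    (hpp : IsPrimePow L.card)
    (hlong : HasLongCycle L) :
    IsPrimitive L := by
  refine ⟨htrans, fun B hB => ?_⟩
  by_contra! h
  obtain ⟨hcard, huniv⟩ := h
  obtain ⟨x, hx, y, hy, hxy⟩ := Finset.one_lt_card.1 hcard
  obtain ⟨w, hw⟩ : ∃ w, w ∉ B := by
    by_contra! h
    exact huniv (Finset.eq_univ_of_forall h)
  refine hxy (eq_of_rel_of_not_rel htrans hpp hlong
    (isInvariant_blockSetoid htrans hB ⟨x, hx⟩) (u := x) (v := w) ⟨1, one_mem _, hx, hy⟩ ?_)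
  rintro ⟨g, hg, hgx, hgw⟩
  rcases hB g hg with heq | hdisj
  · rw [← heq, Finset.mem_image] at hgw
    obtain ⟨b, hb, hbw⟩ := hgw
    exact hw (g.injective hbw ▸ hb)
  · exact Finset.disjoint_left.1 hdisj (Finset.mem_image_of_mem g hx) hgx

end TogglePaper
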